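/- Let (B,n) be a two-dimensional Cohen–Macaulay Noetherian local ring with minimal multiplicity, and let x ∈ n be a B-regular element (a nonzerodivisor). Set A = B/(x), a one-dimensional Cohen–Macaulay local ring. Then for every maximal Cohen–Macaulay A-module M, the Hilbert function of M with respect to the maximal ideal of A is non-decreasing: H(M,n) ≤ H(M,n+1) for all n ≥ 0. -/

import Mathlib

open IsLocalRing

/-- The length of a module, i.e. the Krull dimension of its lattice of submodules. -/
noncomputable def moduleLength (R : Type*) (M : Type*) [CommRing R] [AddCommGroup M]
    [Module R M] : WithBot ℕ∞ :=
  Order.krullDim (Submodule R M)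

/-- The Hilbert function of a module `M` with respect to an ideal `I`:
`n ↦ length (I^n M / I^(n+1) M)`. -/
noncomputable def hilbertFn (R : Type*) (M : Type*) [CommRing R] [AddCommGroup M]
    [Module R M] (I : Ideal R) (n : ℕ) : WithBot ℕ∞ :=
  moduleLength R (↥(I ^ n • (⊤ : Submodule R M)) ⧸
    (Submodule.comap (I ^ n • (⊤ : Submodule R M)).subtype (I ^ (n + 1) • (⊤ : Submodule R M))))

/-- The depth of `M` with respect to the ideal `I`: the supremum of lengths of
`M`-regular sequences consisting of elements of `I`. -/
noncomputable def seqDepth (R : Type*) (M : Type*) [CommRing R] [AddCommGroup M]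
    [Module R M] (I : Ideal R) : ℕ∞ :=
  sSup {n : ℕ∞ | ∃ rs : List R, (rs.length : ℕ∞) = n ∧ (∀ x ∈ rs, x ∈ I) ∧
    RingTheory.Sequence.IsRegular M rs}

/-- A `d`-dimensional Cohen–Macaulay local ring has minimal multiplicity if there is a
system of parameters `x₁, …, x_d` with `𝔫² = (x₁, …, x_d)·𝔫`. -/
def HasMinimalMultiplicity (R : Type*) [CommRing R] [IsLocalRing R] (d : ℕ) : Prop :=
  ∃ x : Fin d → R, (∀ i, x i ∈ maximalIdeal R) ∧
    (maximalIdeal R) ^ 2 = Ideal.span (Set.range x) * maximalIdeal R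

/-- The length of the interval between two submodules `P` and `T`, i.e. of `T / (P ∩ T)`. -/
noncomputable def intervalLength {R X : Type*} [CommRing R] [AddCommGroup X] [Module R X]
    (P T : Submodule R X) : ℕ∞ :=
  Module.length R (T ⧸ P.submoduleOf T)

section IntervalLength

variable {R X Y : Type*} [CommRing R] [AddCommGroup X] [Module R X] [AddCommGroup Y] [Module R Y]

theorem intervalLength_add_eq_of_map (f : X →ₗ[R] Y) {P T : Submodule R X} {P' T' : Submodule R Y}
    (hT : ∀ y ∈ T, f y ∈ T') (hP : ∀ y ∈ T, f y ∈ P' ↔ y ∈ P) :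
    intervalLength P T + intervalLength (P' ⊔ T.map f) T' = intervalLength P' T' := by
  let g : T →ₗ[R] T' := f.restrict hT
  have hg : P.submoduleOf T = (P'.submoduleOf T').comap g := by
    ext y
    simpa [Submodule.submoduleOf, g] using (hP y y.2).symm
  have hle : P'.submoduleOf T' ≤ (P' ⊔ T.map f).submoduleOf T' :=
    Submodule.comap_mono le_sup_left
  let i : (T ⧸ P.submoduleOf T) →ₗ[R] (T' ⧸ P'.submoduleOf T') :=
    Submodule.mapQ _ _ g hg.le
  let q : (T' ⧸ P'.submoduleOf T') →ₗ[R] (T' ⧸ (P' ⊔ T.map f).submoduleOf T') :=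
    Submodule.factor hle
  refine (Module.length_eq_add_of_exact i q ?_ (Submodule.factor_surjective hle) ?_).symm
  · rw [← LinearMap.ker_eq_bot, Submodule.ker_mapQ, ← hg, Submodule.mkQ_map_self]
  · intro z
    obtain ⟨z, rfl⟩ := Submodule.Quotient.mk_surjective _ z
    constructor
    · intro hz
      have hz' : (z : Y) ∈ P' ⊔ T.map f := by
        exact (Submodule.Quotient.mk_eq_zero ((P' ⊔ T.map f).submoduleOf T')).mp hz
      obtain ⟨p, hp, _, ⟨t, ht, rfl⟩, hpt⟩ := Submodule.mem_sup.mp hz'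
      refine ⟨Submodule.Quotient.mk ⟨t, ht⟩, ?_⟩
      change Submodule.Quotient.mk (g ⟨t, ht⟩) = _
      rw [Submodule.Quotient.eq]
      change f t - z ∈ P'
      rw [← hpt, sub_add_cancel_right]
      exact P'.neg_mem hp
    · rintro ⟨w, hw⟩
      obtain ⟨w, rfl⟩ := Submodule.Quotient.mk_surjective _ w
      rw [← hw]
      change Submodule.Quotient.mk (g w) = _
      rw [Submodule.Quotient.mk_eq_zero]
      exact Submodule.mem_sup_right ⟨w, w.2, rfl⟩

theorem intervalLength_add {P T U : Submodule R X} (hPT : P ≤ T) (hTU : T ≤ U) :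
    intervalLength P T + intervalLength T U = intervalLength P U := by
  have := intervalLength_add_eq_of_map LinearMap.id (P := P) (T := T) (P' := P) (T' := U)
    (fun y hy ↦ hTU hy) (fun _ _ ↦ Iff.rfl)
  rwa [Submodule.map_id, sup_eq_right.mpr hPT] at this

theorem intervalLength_anti_left {P Q T : Submodule R X} (h : P ≤ Q) :
    intervalLength Q T ≤ intervalLength P T :=
  Module.length_le_of_surjective (Submodule.factor (Submodule.comap_mono h))
    (Submodule.factor_surjective _)

theorem intervalLength_eq_zero {P T : Submodule R X} (h : T ≤ P) : intervalLength P T = 0 := by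
  rw [intervalLength, Module.length_eq_zero_iff, Submodule.Quotient.subsingleton_iff,
    Submodule.submoduleOf_eq_top]
  exact h

theorem isArtinianRing_quotient_maximalIdeal_pow [IsNoetherianRing R] [IsLocalRing R] (k : ℕ) :
    IsArtinianRing (R ⧸ maximalIdeal R ^ k) := by
  rcases subsingleton_or_nontrivial (R ⧸ maximalIdeal R ^ k) with h | h
  · infer_instance
  have : IsLocalRing (R ⧸ maximalIdeal R ^ k) :=
    .of_surjective' (Ideal.Quotient.mk _) Ideal.Quotient.mk_surjective
  rw [isArtinianRing_iff_isNilpotent_maximalIdeal]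
  refine ⟨k, ?_⟩
  rw [← IsLocalRing.map_maximalIdeal_of_surjective (Ideal.Quotient.mk (maximalIdeal R ^ k))
    Ideal.Quotient.mk_surjective, ← Ideal.map_pow, Ideal.map_quotient_self, Ideal.zero_eq_bot]

theorem intervalLength_ne_top [IsNoetherianRing R] [IsLocalRing R] [Module.Finite R X]
    {P T : Submodule R X} (k : ℕ) (h : maximalIdeal R ^ k • T ≤ P) :
    intervalLength P T ≠ ⊤ := by
  have := isArtinianRing_quotient_maximalIdeal_pow (R := R) k
  let I := maximalIdeal R ^ k
  have hle : I • (⊤ : Submodule R T) ≤ P.submoduleOf T := by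
    rw [Submodule.submoduleOf, ← Submodule.map_le_iff_le_comap, Submodule.map_smul'',
      Submodule.map_subtype_top]
    exact h
  have h1 : Module.length R (T ⧸ I • (⊤ : Submodule R T)) ≠ ⊤ := by
    rw [Module.length_eq_of_surjective (R := R ⧸ I) Ideal.Quotient.mk_surjective]
    have : Module.Finite (R ⧸ I) (T ⧸ I • (⊤ : Submodule R T)) :=
      Module.Finite.of_restrictScalars_finite R _ _
    exact Module.length_ne_top
  exact ne_top_of_le_ne_top h1 (Module.length_le_of_surjective (Submodule.factor hle)
    (Submodule.factor_surjective hle))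

end IntervalLength

section Colon

variable {R X : Type*} [CommRing R] [AddCommGroup X] [Module R X]

theorem Ideal.pow_succ_eq_of_sq_eq {I : Ideal R} {a b : R} (ha : a ∈ I) (hb : b ∈ I)
    (h : I ^ 2 = Ideal.span {a, b} * I) (k : ℕ) :
    I ^ (k + 1) = Ideal.span {a} * I ^ k ⊔ Ideal.span {b ^ k} * I := by
  have ha' : Ideal.span {a} ≤ I := (Ideal.span_singleton_le_iff_mem I).mpr ha
  have hb' : Ideal.span {b} ≤ I := (Ideal.span_singleton_le_iff_mem I).mpr hb
  induction k with
  | zero => simpa using ha'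
  | succ k ih =>
    apply le_antisymm
    · calc I ^ (k + 1 + 1) = Ideal.span {a} * I ^ (k + 1) ⊔ Ideal.span {b ^ k} * I ^ 2 := by
            rw [pow_succ, ih, Ideal.sup_mul, mul_assoc, mul_assoc, ← pow_succ, ← sq, ← ih]
        _ = Ideal.span {a} * I ^ (k + 1) ⊔
              (Ideal.span {a} * (Ideal.span {b} ^ k * I) ⊔ Ideal.span {b ^ (k + 1)} * I) := by
            rw [h, Ideal.span_insert, Ideal.sup_mul, Ideal.mul_sup, Ideal.span_singleton_pow,
              ← mul_assoc (Ideal.span {b ^ k}) (Ideal.span {b}),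
              Ideal.span_singleton_mul_span_singleton, ← pow_succ, mul_left_comm]
        _ ≤ _ := by
            refine sup_le le_sup_left (sup_le (le_sup_of_le_left (Ideal.mul_mono_right ?_))
              le_sup_right)
            rw [pow_succ]
            exact Ideal.mul_mono_left (Ideal.pow_right_mono hb' k)
    · refine sup_le ?_ ?_
      · rw [pow_succ' I (k + 1)]
        exact Ideal.mul_mono_left ha'
      · rw [pow_succ I (k + 1), ← Ideal.span_singleton_pow]
        exact Ideal.mul_mono_left (Ideal.pow_right_mono hb' _)

theorem exists_eq_smul_add_of_mem_pow_smul {I : Ideal R} {a b : R} (ha : a ∈ I) (hb : b ∈ I)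
    (h : I ^ 2 = Ideal.span {a, b} * I) {N : Submodule R X} {k : ℕ} {y : X}
    (hy : y ∈ I ^ (k + 1) • N) :
    ∃ u ∈ I ^ k • N, ∃ v ∈ I • N, y = a • u + b ^ k • v := by
  rw [Ideal.pow_succ_eq_of_sq_eq ha hb h, Submodule.sup_smul, mul_smul, mul_smul,
    Submodule.ideal_span_singleton_smul, Submodule.ideal_span_singleton_smul,
    Submodule.mem_sup] at hy
  obtain ⟨_, ⟨u, hu, rfl⟩, _, ⟨v, hv, rfl⟩, rfl⟩ := hy
  exact ⟨u, hu, v, hv, rfl⟩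

/-- The relation `b • y = a • z` in `N` forces `y ∈ a N`, i.e. `b` is a nonzerodivisor
on `N / a N`. -/
def IsRegularModulo (N : Submodule R X) (a b : R) : Prop :=
  ∀ y ∈ N, ∀ z ∈ N, b • y = a • z → ∃ w ∈ N, y = a • w

theorem IsRegularModulo.pow_right {N : Submodule R X} {a b : R} (h : IsRegularModulo N a b)
    (k : ℕ) : IsRegularModulo N a (b ^ k) := by
  induction k with
  | zero => exact fun y _ z hz e ↦ ⟨z, hz, by simpa using e⟩
  | succ k ih =>
    intro y hy z hz e
    rw [pow_succ', mul_smul] at e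
    obtain ⟨w, hw, e'⟩ := h _ (N.smul_mem _ hy) z hz e
    exact ih y hy w hw e'

theorem mem_pow_smul_of_smul_mem {I : Ideal R} {a b : R} (ha : a ∈ I) (hb : b ∈ I)
    (h : I ^ 2 = Ideal.span {a, b} * I) {N : Submodule R X} (hreg : IsSMulRegular X a)
    (hN : IsRegularModulo N a b) {k : ℕ} {y : X} (hy : y ∈ N) (hay : a • y ∈ I ^ (k + 1) • N) :
    y ∈ I ^ k • N := by
  obtain ⟨u, hu, v, hv, e⟩ := exists_eq_smul_add_of_mem_pow_smul ha hb h hay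
  have hu' : u ∈ N := Submodule.smul_le_right hu
  obtain ⟨w, hw, rfl⟩ := hN.pow_right k v (Submodule.smul_le_right hv) (y - u) (N.sub_mem hy hu')
    (by rw [smul_sub, e, add_sub_cancel_left])
  rw [smul_comm, ← smul_add] at e
  rw [hreg e]
  exact add_mem hu (Submodule.smul_mem_smul (Ideal.pow_mem_pow hb k) hw)

theorem exists_eq_add_smul_of_smul_eq {I : Ideal R} {a b : R} (ha : a ∈ I) (hb : b ∈ I)
    (h : I ^ 2 = Ideal.span {a, b} * I) {N : Submodule R X}
    (hN : IsRegularModulo N a b) {k : ℕ} {y z c : X} (hy : y ∈ N) (hz : z ∈ N)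
    (hc : c ∈ I ^ (k + 1) • N) (e : b • y = c + a • z) :
    ∃ d ∈ I ^ k • N, ∃ w ∈ N, y = d + a • w := by
  cases k with
  | zero => exact ⟨y, by simpa using hy, 0, N.zero_mem, by simp⟩
  | succ k =>
    obtain ⟨u, hu, v, hv, rfl⟩ := exists_eq_smul_add_of_mem_pow_smul ha hb h hc
    have hu' : u ∈ N := Submodule.smul_le_right hu
    have hv' : v ∈ N := Submodule.smul_le_right hv
    obtain ⟨w, hw, e'⟩ := hN (y - b ^ k • v) (N.sub_mem hy (N.smul_mem _ hv')) (u + z)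
      (N.add_mem hu' hz) (by rw [smul_sub, e, smul_add, pow_succ', mul_smul]; abel)
    refine ⟨b ^ k • v, ?_, w, hw, by rw [← e']; abel⟩
    rw [pow_succ, mul_smul]
    exact Submodule.smul_mem_smul (Ideal.pow_mem_pow hb k) hv

end Colon

section SecondDifference

variable {R X : Type*} [CommRing R] [AddCommGroup X] [Module R X]

open scoped Pointwise in
theorem intervalLength_second_difference {P T : ℕ → Submodule R X} {a b : R}
    (hTa : ∀ n, ∀ y ∈ T n, a • y ∈ T (n + 1)) (hTb : ∀ n, ∀ y ∈ T n, b • y ∈ T (n + 1))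
    (hPa : ∀ n, ∀ y ∈ T n, a • y ∈ P (n + 1) ↔ y ∈ P n)
    (hPb : ∀ n, ∀ y ∈ T (n + 1),
      b • y ∈ P (n + 2) ⊔ a • T (n + 1) ↔ y ∈ P (n + 1) ⊔ a • T n) (n : ℕ) :
    intervalLength (P n) (T n) + intervalLength (P (n + 2)) (T (n + 2)) =
      2 * intervalLength (P (n + 1)) (T (n + 1)) +
        intervalLength (P (n + 2) ⊔ a • T (n + 1) ⊔ b • T (n + 1)) (T (n + 2)) := by
  have h0 : ∀ k, _ := fun k ↦ intervalLength_add_eq_of_map (DistribSMul.toLinearMap R X a)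
    (hTa k) (hPa k)
  have h1 := intervalLength_add_eq_of_map (DistribSMul.toLinearMap R X b) (hTb (n + 1)) (hPb n)
  change ∀ k, _ + intervalLength (P (k + 1) ⊔ a • T k) _ = _ at h0
  change _ + intervalLength (P (n + 2) ⊔ a • T (n + 1) ⊔ b • T (n + 1)) _ = _ at h1
  have h2 := h0 (n + 1)
  rw [← h1] at h2
  rw [← h2, ← h0 n]
  ring

variable {I : Ideal R} {a b : R}

open scoped Pointwise in
theorem intervalLength_pow_smul_second_difference (ha : a ∈ I) (hb : b ∈ I)
    (h : I ^ 2 = Ideal.span {a, b} * I) {N : Submodule R X} (hreg : IsSMulRegular X a)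
    (hN : IsRegularModulo N a b) (n : ℕ) :
    intervalLength (I ^ n • N) N + intervalLength (I ^ (n + 2) • N) N =
      2 * intervalLength (I ^ (n + 1) • N) N + intervalLength (a • N ⊔ b • N) N := by
  have := intervalLength_second_difference (P := fun n ↦ I ^ n • N) (T := fun _ ↦ N) (a := a)
    (b := b) (fun _ y hy ↦ N.smul_mem _ hy) (fun _ y hy ↦ N.smul_mem _ hy)
    (fun k y hy ↦ ⟨mem_pow_smul_of_smul_mem ha hb h hreg hN hy, fun hy' ↦ by
      rw [pow_succ', mul_smul]; exact Submodule.smul_mem_smul ha hy'⟩)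
    (fun k y hy ↦ ⟨fun hy' ↦ ?_, fun hy' ↦ ?_⟩) n
  · rw [this]
    congr 2
    rw [sup_assoc, sup_eq_right, pow_add, h, mul_smul]
    refine Submodule.smul_le_right.trans ?_
    rw [mul_smul, Ideal.span_insert, Submodule.sup_smul, Submodule.ideal_span_singleton_smul,
      Submodule.ideal_span_singleton_smul]
    gcongr <;> exact Submodule.smul_le_right
  · obtain ⟨c, hc, _, ⟨z, hz, rfl⟩, e⟩ := Submodule.mem_sup.mp hy'
    obtain ⟨d, hd, w, hw, rfl⟩ := exists_eq_add_smul_of_smul_eq ha hb h hN hy hz hc e.symm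
    exact Submodule.add_mem_sup hd (Submodule.smul_mem_pointwise_smul _ _ _ hw)
  · obtain ⟨c, hc, _, ⟨z, hz, rfl⟩, rfl⟩ := Submodule.mem_sup.mp hy'
    rw [smul_add]
    refine Submodule.add_mem_sup ?_ ?_
    · rw [pow_succ', mul_smul]; exact Submodule.smul_mem_smul hb hc
    · change b • a • z ∈ _
      rw [smul_comm]
      exact Submodule.smul_mem_pointwise_smul _ _ _ (N.smul_mem _ hz)

theorem smul_mem_pow_succ_smul {r : R} (hr : r ∈ I) {N : Submodule R X} {k : ℕ} {y : X}
    (hy : y ∈ I ^ k • N) : r • y ∈ I ^ (k + 1) • N := by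
  rw [pow_succ', mul_smul]
  exact Submodule.smul_mem_smul hr hy

open scoped Pointwise in
theorem two_mul_intervalLength_inf_le (ha : a ∈ I) (hb : b ∈ I)
    (h : I ^ 2 = Ideal.span {a, b} * I) {N : Submodule R X} (hreg : IsSMulRegular X a)
    (hN : IsRegularModulo N a b) (hX : IsRegularModulo (⊤ : Submodule R X) a b) (n : ℕ) :
    2 * intervalLength (I ^ (n + 1) • N) (N ⊓ I ^ (n + 1) • ⊤) ≤
      intervalLength (I ^ n • N) (N ⊓ I ^ n • ⊤) +
        intervalLength (I ^ (n + 2) • N) (N ⊓ I ^ (n + 2) • ⊤) := by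
  have hT : ∀ r ∈ I, ∀ k, ∀ y ∈ N ⊓ I ^ k • ⊤, r • y ∈ N ⊓ I ^ (k + 1) • ⊤ :=
    fun r hr k y hy ↦ ⟨N.smul_mem _ hy.1, smul_mem_pow_succ_smul hr hy.2⟩
  have := intervalLength_second_difference (P := fun n ↦ I ^ n • N)
    (T := fun n ↦ N ⊓ I ^ n • ⊤) (hT a ha) (hT b hb)
    (fun k y hy ↦ ⟨mem_pow_smul_of_smul_mem ha hb h hreg hN hy.1, smul_mem_pow_succ_smul ha⟩)
    (fun k y hy ↦ ⟨fun hy' ↦ ?_, fun hy' ↦ ?_⟩) n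
  · exact this ▸ le_self_add
  · obtain ⟨c, hc, _, ⟨z, hz, rfl⟩, e⟩ := Submodule.mem_sup.mp hy'
    obtain ⟨d, hd, w, hw, rfl⟩ := exists_eq_add_smul_of_smul_eq ha hb h hN hy.1 hz.1 hc e.symm
    refine Submodule.add_mem_sup hd (Submodule.smul_mem_pointwise_smul _ _ _ ⟨hw, ?_⟩)
    refine mem_pow_smul_of_smul_mem ha hb h hreg hX trivial ?_
    have := sub_mem hy.2 (Submodule.smul_mono le_rfl le_top hd)
    rwa [add_sub_cancel_left] at this
  · obtain ⟨c, hc, _, ⟨z, hz, rfl⟩, rfl⟩ := Submodule.mem_sup.mp hy'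
    rw [smul_add]
    refine Submodule.add_mem_sup (smul_mem_pow_succ_smul hb hc) ?_
    change b • a • z ∈ _
    rw [smul_comm]
    exact Submodule.smul_mem_pointwise_smul _ _ _ (hT b hb k z hz)

end SecondDifference

section Main

theorem le_of_second_difference_eq {s t : ℕ → ℕ} {d e c : ℕ} (hs0 : s 0 = 0) (ht0 : t 0 = 0)
    (hs : ∀ n, s n + s (n + 2) = 2 * s (n + 1) + d)
    (ht : ∀ n, t n + t (n + 2) = 2 * t (n + 1) + e) (hst : ∀ n, s n ≤ t (n + c)) : d ≤ e := by
  have closed : ∀ (u : ℕ → ℕ) (f : ℕ), u 0 = 0 → (∀ n, u n + u (n + 2) = 2 * u (n + 1) + f) →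
      ∀ n, (2 * u n : ℤ) = f * (n * (n - 1)) + 2 * n * u 1 := by
    intro u f h0 h n
    induction n using Nat.twoStepInduction with
    | zero => simp [h0]
    | one => simp
    | more n ih1 ih2 =>
      have := h n
      zify at this
      push_cast at ih2 ⊢
      linear_combination 2 * this - ih1 + 2 * ih2
  by_contra! hlt
  have hs' := closed s d hs0 hs
  have ht' := closed t e ht0 ht
  set K : ℤ := 2 * e * c + 2 * t 1 + (e * c ^ 2 + 2 * t 1 * c) with hK
  have hK0 : 0 ≤ K := by positivity
  obtain ⟨k, hk⟩ := Int.eq_ofNat_of_zero_le (show 0 ≤ K + 2 by lia)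
  have h1 := hs' k
  have h2 := ht' (k + c)
  have h3 : (s k : ℤ) ≤ t (k + c) := mod_cast hst k
  push_cast at h2
  have hd : (e : ℤ) + 1 ≤ d := mod_cast hlt
  have hk1 : (0 : ℤ) ≤ k * (k - 1) := by nlinarith
  have h4 : ((e : ℤ) + 1) * (k * (k - 1)) ≤ d * (k * (k - 1)) :=
    mul_le_mul_of_nonneg_right hd hk1
  have h5 : (0 : ℤ) ≤ 2 * k * s 1 := by positivity
  have h6 : (k : ℤ) * (k - 1) ≤
      (2 * e * c + 2 * t 1) * k + (e * c ^ 2 + 2 * t 1 * c) - e * c := by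
    linear_combination h4 + h5 + 2 * h3 - h1 + h2
  have h7 : (0 : ℤ) ≤ e * c := by positivity
  have h8 : (e * c ^ 2 + 2 * t 1 * c : ℤ) ≤ (e * c ^ 2 + 2 * t 1 * c) * k :=
    le_mul_of_one_le_right (by positivity) (by lia)
  have h9 : (k : ℤ) * (k - 1) ≤ K * k := by rw [hK]; linarith
  nlinarith

variable {R X : Type*} [CommRing R] [IsNoetherianRing R] [IsLocalRing R] [AddCommGroup X]
  [Module R X] [Module.Finite R X] {a b : R}

open scoped Pointwise in
theorem intervalLength_smul_sup_smul_ne_top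
    (h : maximalIdeal R ^ 2 = Ideal.span {a, b} * maximalIdeal R) (L : Submodule R X) :
    intervalLength (a • L ⊔ b • L) L ≠ ⊤ := by
  refine intervalLength_ne_top 2 ?_
  rw [h, mul_smul]
  refine (Submodule.smul_mono le_rfl Submodule.smul_le_right).trans_eq ?_
  rw [Ideal.span_insert, Submodule.sup_smul, Submodule.ideal_span_singleton_smul,
    Submodule.ideal_span_singleton_smul]

open scoped Pointwise in
theorem intervalLength_smul_sup_smul_le (ha : a ∈ maximalIdeal R) (hb : b ∈ maximalIdeal R)
    (h : maximalIdeal R ^ 2 = Ideal.span {a, b} * maximalIdeal R) {N : Submodule R X}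
    (hreg : IsSMulRegular X a) (hN : IsRegularModulo N a b)
    (hX : IsRegularModulo (⊤ : Submodule R X) a b) :
    intervalLength (a • N ⊔ b • N) N ≤
      intervalLength (a • (⊤ : Submodule R X) ⊔ b • (⊤ : Submodule R X)) ⊤ := by
  have hfin : ∀ (L : Submodule R X) n, intervalLength (maximalIdeal R ^ n • L) L ≠ ⊤ :=
    fun L n ↦ intervalLength_ne_top n le_rfl
  have hfin' := intervalLength_smul_sup_smul_ne_top (X := X) h
  obtain ⟨c, hc⟩ := Ideal.exists_pow_inf_eq_pow_smul (maximalIdeal R) N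
  have hrec : ∀ L : Submodule R X, IsRegularModulo L a b → ∀ n,
      (intervalLength (maximalIdeal R ^ n • L) L).toNat +
        (intervalLength (maximalIdeal R ^ (n + 2) • L) L).toNat =
      2 * (intervalLength (maximalIdeal R ^ (n + 1) • L) L).toNat +
        (intervalLength (a • L ⊔ b • L) L).toNat := by
    intro L hL n
    have := intervalLength_pow_smul_second_difference ha hb h hreg hL n
    rw [← ENat.natCast_inj]
    push_cast
    simpa only [ENat.natCast_toNat (hfin L _), ENat.natCast_toNat (hfin' L)] using this
  rw [← ENat.natCast_toNat (hfin' N), ← ENat.natCast_toNat (hfin' ⊤), Nat.cast_le]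
  refine le_of_second_difference_eq (c := c) ?_ ?_ (hrec N hN) (hrec ⊤ hX) fun n ↦ ?_
  · rw [intervalLength_eq_zero (by simp), ENat.toNat_zero]
  · rw [intervalLength_eq_zero (by simp), ENat.toNat_zero]
  · refine ENat.toNat_le_toNat ?_ (hfin _ _)
    calc intervalLength (maximalIdeal R ^ n • N) N
        ≤ intervalLength (maximalIdeal R ^ (n + c) • ⊤ ⊓ N) N := by
          refine intervalLength_anti_left ?_
          rw [hc _ (Nat.le_add_left c n), Nat.add_sub_cancel]
          exact Submodule.smul_mono le_rfl inf_le_right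
      _ ≤ intervalLength (maximalIdeal R ^ (n + c) • ⊤) ⊤ := by
          rw [← intervalLength_add_eq_of_map LinearMap.id (P := maximalIdeal R ^ (n + c) • ⊤ ⊓ N)
            (T := N) (P' := maximalIdeal R ^ (n + c) • ⊤) (T' := ⊤) (fun _ _ ↦ trivial)
            (fun y hy ↦ ⟨fun hy' ↦ ⟨hy', hy⟩, fun hy' ↦ hy'.1⟩)]
          exact le_self_add

theorem intervalLength_pow_smul_sup_le (ha : a ∈ maximalIdeal R) (hb : b ∈ maximalIdeal R)
    (h : maximalIdeal R ^ 2 = Ideal.span {a, b} * maximalIdeal R) {N : Submodule R X}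
    (hreg : IsSMulRegular X a) (hN : IsRegularModulo N a b)
    (hX : IsRegularModulo (⊤ : Submodule R X) a b) (n : ℕ) :
    intervalLength (maximalIdeal R ^ (n + 1) • ⊤ ⊔ N) (maximalIdeal R ^ n • ⊤ ⊔ N) ≤
      intervalLength (maximalIdeal R ^ (n + 2) • ⊤ ⊔ N) (maximalIdeal R ^ (n + 1) • ⊤ ⊔ N) := by
  set I := maximalIdeal R with hI
  have hIT : ∀ k, I ^ (k + 1) • (⊤ : Submodule R X) ≤ I ^ k • ⊤ := fun k ↦
    Submodule.smul_mono (Ideal.pow_le_pow_right k.le_succ) le_rfl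
  have hIN : ∀ k, I ^ k • N ≤ N ⊓ I ^ k • ⊤ := fun k ↦
    le_inf Submodule.smul_le_right (Submodule.smul_mono le_rfl le_top)
  have e1 : ∀ k, intervalLength (N ⊓ I ^ k • ⊤) N + intervalLength (I ^ k • ⊤ ⊔ N) ⊤ =
      intervalLength (I ^ k • (⊤ : Submodule R X)) ⊤ := fun k ↦ by
    have := intervalLength_add_eq_of_map LinearMap.id (P := N ⊓ I ^ k • ⊤)
      (T := N) (P' := I ^ k • ⊤) (T' := ⊤) (fun _ _ ↦ trivial)
      (fun y hy ↦ ⟨fun hy' ↦ ⟨hy, hy'⟩, fun hy' ↦ hy'.2⟩)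
    rwa [Submodule.map_id] at this
  have e2 : ∀ k, intervalLength (I ^ k • N) (N ⊓ I ^ k • ⊤) + intervalLength (N ⊓ I ^ k • ⊤) N =
      intervalLength (I ^ k • N) N := fun k ↦ intervalLength_add (hIN k) inf_le_left
  have e3 : ∀ k, intervalLength (I ^ (k + 1) • ⊤ ⊔ N) (I ^ k • ⊤ ⊔ N) +
      intervalLength (I ^ k • ⊤ ⊔ N) ⊤ = intervalLength (I ^ (k + 1) • ⊤ ⊔ N) ⊤ := fun k ↦
    intervalLength_add (sup_le_sup_right (hIT k) N) le_top
  have dN := intervalLength_pow_smul_second_difference ha hb h hreg hN n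
  have dX := intervalLength_pow_smul_second_difference ha hb h hreg hX n
  have dV := two_mul_intervalLength_inf_le ha hb h hreg hN hX n
  have hle := intervalLength_smul_sup_smul_le ha hb h hreg hN hX
  have fN : ∀ k, intervalLength (I ^ k • N) N ≠ ⊤ := fun k ↦ intervalLength_ne_top k le_rfl
  have fX : ∀ k, intervalLength (I ^ k • (⊤ : Submodule R X)) ⊤ ≠ ⊤ :=
    fun k ↦ intervalLength_ne_top k le_rfl
  have fV : ∀ k, intervalLength (I ^ k • N) (N ⊓ I ^ k • ⊤) ≠ ⊤ := fun k ↦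
    ne_top_of_le_ne_top (fN k) (e2 k ▸ le_self_add)
  have fC : ∀ k, intervalLength (N ⊓ I ^ k • ⊤) N ≠ ⊤ := fun k ↦
    ne_top_of_le_ne_top (fN k) (e2 k ▸ le_add_self)
  have fM : ∀ k, intervalLength (I ^ k • ⊤ ⊔ N) ⊤ ≠ ⊤ := fun k ↦
    ne_top_of_le_ne_top (fX k) (e1 k ▸ le_add_self)
  have fH : ∀ k, intervalLength (I ^ (k + 1) • ⊤ ⊔ N) (I ^ k • ⊤ ⊔ N) ≠ ⊤ := fun k ↦
    ne_top_of_le_ne_top (fM (k + 1)) (e3 k ▸ le_self_add)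
  have fe := intervalLength_smul_sup_smul_ne_top h (⊤ : Submodule R X)
  have fd := intervalLength_smul_sup_smul_ne_top h N
  choose sN hsN using fun k ↦ ENat.ne_top_iff_exists.mp (fN k)
  choose sX hsX using fun k ↦ ENat.ne_top_iff_exists.mp (fX k)
  choose sV hsV using fun k ↦ ENat.ne_top_iff_exists.mp (fV k)
  choose sC hsC using fun k ↦ ENat.ne_top_iff_exists.mp (fC k)
  choose sM hsM using fun k ↦ ENat.ne_top_iff_exists.mp (fM k)
  choose sH hsH using fun k ↦ ENat.ne_top_iff_exists.mp (fH k)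
  obtain ⟨e, he⟩ := ENat.ne_top_iff_exists.mp fe
  obtain ⟨d, hd⟩ := ENat.ne_top_iff_exists.mp fd
  have g1 := fun k ↦ e1 k
  have g2 := fun k ↦ e2 k
  have g3 := fun k ↦ e3 k
  simp only [← hsN, ← hsX, ← hsV, ← hsC, ← hsM, ← hsH, ← he, ← hd] at g1 g2 g3 dN dX dV hle ⊢
  norm_cast at g1 g2 g3 dN dX dV hle ⊢
  have g10 := g1 n
  have g11 := g1 (n + 1)
  have g12 := g1 (n + 2)
  have g20 := g2 n
  have g21 := g2 (n + 1)
  have g22 := g2 (n + 2)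
  have g30 := g3 n
  have g31 := g3 (n + 1)
  change sH n ≤ sH (n + 1)
  lia

end Main

section Depth

theorem moduleLength_eq_coe_length (R M : Type*) [CommRing R] [AddCommGroup M] [Module R M] :
    moduleLength R M = (Module.length R M : WithBot ℕ∞) :=
  (Module.coe_length R M).symm

theorem hilbertFn_map_eq_intervalLength {R S X M : Type*} [CommRing R] [CommRing S] [Algebra R S]
    [AddCommGroup X] [Module R X] [AddCommGroup M] [Module R M] [Module S M] [IsScalarTower R S M]
    (hS : Function.Surjective (algebraMap R S)) (f : X →ₗ[R] M) (hf : Function.Surjective f)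
    (I : Ideal R) (n : ℕ) :
    hilbertFn S M (I.map (algebraMap R S)) n =
      (intervalLength (I ^ (n + 1) • ⊤ ⊔ LinearMap.ker f) (I ^ n • ⊤ ⊔ LinearMap.ker f) :
        ℕ∞) := by
  rw [hilbertFn, moduleLength_eq_coe_length, WithBot.coe_inj,
    ← Module.length_eq_of_surjective (S := R) hS]
  have key : ∀ k, ∀ y, f y ∈ I.map (algebraMap R S) ^ k • (⊤ : Submodule S M) ↔
      y ∈ I ^ k • ⊤ ⊔ LinearMap.ker f := by
    intro k y
    rw [← Submodule.restrictScalars_mem R, ← Ideal.map_pow, Ideal.smul_restrictScalars,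
      Submodule.restrictScalars_top, ← LinearMap.range_eq_top.mpr hf, ← Submodule.map_top,
      ← Submodule.map_smul'', ← Submodule.mem_comap, Submodule.comap_map_eq]
  let g : ↥(I ^ n • ⊤ ⊔ LinearMap.ker f) →ₗ[R]
      ↥(I.map (algebraMap R S) ^ n • (⊤ : Submodule S M)) :=
    { toFun := fun y ↦ ⟨f y, (key n y).mpr y.2⟩
      map_add' := fun y z ↦ Subtype.ext (map_add f _ _)
      map_smul' := fun r y ↦ Subtype.ext (map_smul f _ _) }
  let q := (((I.map (algebraMap R S) ^ (n + 1) • (⊤ : Submodule S M)).comap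
    (I.map (algebraMap R S) ^ n • (⊤ : Submodule S M)).subtype).mkQ.restrictScalars R) ∘ₗ g
  have hq : Function.Surjective q := by
    intro z
    obtain ⟨⟨z, hz⟩, rfl⟩ := Submodule.Quotient.mk_surjective _ z
    obtain ⟨y, rfl⟩ := hf z
    exact ⟨⟨y, (key n y).mp hz⟩, rfl⟩
  have hker : LinearMap.ker q =
      (I ^ (n + 1) • ⊤ ⊔ LinearMap.ker f).submoduleOf (I ^ n • ⊤ ⊔ LinearMap.ker f) := by
    ext y
    refine (Submodule.Quotient.mk_eq_zero _).trans ?_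
    exact key (n + 1) y
  rw [intervalLength, ← hker]
  exact (q.quotKerEquivOfSurjective hq).length_eq.symm

variable {R : Type*} [CommRing R]

open RingTheory.Sequence in
theorem exists_isSMulRegular_of_zero_lt_seqDepth {M : Type*} [AddCommGroup M] [Module R M]
    {I : Ideal R} (h : 0 < seqDepth R M I) : ∃ c ∈ I, IsSMulRegular M c := by
  obtain ⟨_, ⟨rs, rfl, hI, hreg⟩, hlt⟩ := lt_sSup_iff.mp h
  cases rs with
  | nil => simp at hlt
  | cons c rs => exact ⟨c, hI c (by simp), ((isRegular_cons_iff M c rs).mp hreg).1⟩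

open RingTheory.Sequence in
theorem exists_isRegularModulo_of_one_lt_seqDepth {I : Ideal R} (h : 1 < seqDepth R R I) :
    ∃ p ∈ I, ∃ q ∈ I, IsSMulRegular R p ∧ IsRegularModulo (⊤ : Ideal R) p q := by
  obtain ⟨_, ⟨rs, rfl, hI, hreg⟩, hlt⟩ := lt_sSup_iff.mp h
  rcases rs with _ | ⟨p, _ | ⟨q, rs⟩⟩
  · simp at hlt
  · simp at hlt
  have h1 := (isRegular_cons_iff R p _).mp hreg
  have h2 := (isRegular_cons_iff _ q _).mp h1.2
  refine ⟨p, hI p (by simp), q, hI q (by simp), h1.1, fun y _ z _ e ↦ ?_⟩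
  have : (Submodule.Quotient.mk y : QuotSMulTop p R) = 0 := by
    apply h2.1
    change q • Submodule.Quotient.mk y = q • (0 : QuotSMulTop p R)
    rw [smul_zero, ← Submodule.Quotient.mk_smul, e, Submodule.Quotient.mk_eq_zero]
    exact Submodule.smul_mem_pointwise_smul _ _ _ trivial
  obtain ⟨w, -, hw⟩ := (Submodule.Quotient.mk_eq_zero _).mp this
  exact ⟨w, trivial, hw.symm⟩

/-- If `(a, b)` contains a regular sequence `p, q`, then the first Koszul homology of `a, b`
vanishes. -/
theorem exists_koszul_boundary {a b p q : R} (hp : p ∈ Ideal.span {a, b})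
    (hq : q ∈ Ideal.span {a, b}) (hreg : IsSMulRegular R p)
    (hpq : IsRegularModulo (⊤ : Ideal R) p q) {u v : R} (e : a * u + b * v = 0) :
    ∃ w, u = b * w ∧ v = -(a * w) := by
  obtain ⟨α, β, rfl⟩ := Ideal.mem_span_pair.mp hp
  obtain ⟨γ, δ, rfl⟩ := Ideal.mem_span_pair.mp hq
  set p := α * a + β * b with hpd
  set q := γ * a + δ * b with hqd
  have hcancel : ∀ {s t : R}, p * s = p * t → s = t := fun h ↦ hreg h
  obtain ⟨w, -, hw⟩ := hpq (β * u - α * v) trivial (δ * u - γ * v) trivial <| by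
    apply hcancel
    simp only [smul_eq_mul]
    rw [hpd, hqd]
    linear_combination (γ * β - α * δ) * (α * a + β * b) * e
  rw [smul_eq_mul] at hw
  refine ⟨w, hcancel ?_, hcancel ?_⟩
  · rw [hpd] at hw ⊢
    linear_combination b * hw + α * e
  · rw [hpd] at hw ⊢
    linear_combination -a * hw + β * e

theorem isRegularModulo_pow_pow {p q : R} (hreg : IsSMulRegular R p)
    (hpq : IsRegularModulo (⊤ : Ideal R) p q) (k l : ℕ) :
    IsRegularModulo (⊤ : Ideal R) (p ^ k) (q ^ l) := by
  induction k with
  | zero => exact fun y _ z _ _ ↦ ⟨y, trivial, by simp⟩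
  | succ k ih =>
    intro y _ z _ e
    rw [pow_succ', mul_smul] at e
    obtain ⟨w, -, rfl⟩ := hpq.pow_right l y trivial _ trivial e
    rw [smul_comm] at e
    obtain ⟨w', -, rfl⟩ := ih w trivial z trivial (hreg e)
    exact ⟨w', trivial, by rw [pow_succ', mul_smul]⟩

theorem isSMulRegular_of_koszul [IsNoetherianRing R] [IsLocalRing R] {a b : R}
    (hb : b ∈ maximalIdeal R)
    (hK : ∀ u v : R, a * u + b * v = 0 → ∃ w, u = b * w ∧ v = -(a * w)) :
    IsSMulRegular R a := by
  have hbot : LinearMap.ker (LinearMap.mulLeft R a) = ⊥ := by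
    refine Submodule.eq_bot_of_le_smul_of_le_jacobson_bot (maximalIdeal R) _
      (IsNoetherian.noetherian _) ?_ (maximalIdeal_le_jacobson _)
    intro u hu
    rw [LinearMap.mem_ker, LinearMap.mulLeft_apply] at hu
    obtain ⟨w, rfl, hw⟩ := hK u 0 (by rw [hu]; ring)
    refine Submodule.smul_mem_smul hb ?_
    rw [LinearMap.mem_ker, LinearMap.mulLeft_apply]
    exact neg_eq_zero.mp hw.symm
  exact LinearMap.ker_eq_bot.mp hbot

theorem isRegularModulo_ker_of_koszul {ι X : Type*} [AddCommGroup X] [Module R X] {a b c : R}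
    (hK : ∀ u v : R, a * u + b * v = 0 → ∃ w, u = b * w ∧ v = -(a * w))
    (hc : c ∈ Ideal.span {a, b}) (hX : IsSMulRegular X c) (f : (ι → R) →ₗ[R] X) :
    IsRegularModulo (LinearMap.ker f) a b := by
  intro y hy z hz e
  have (i : ι) : ∃ w, y i = a * w ∧ z i = b * w := by
    obtain ⟨w, h1, h2⟩ := hK (z i) (-y i) (by
      have := congrFun e i
      simp only [Pi.smul_apply, smul_eq_mul] at this
      linear_combination -this)
    exact ⟨w, neg_injective h2, h1⟩
  choose w hyw hzw using this
  obtain rfl : y = a • w := funext hyw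
  obtain rfl : z = b • w := funext hzw
  refine ⟨w, ?_, rfl⟩
  rw [LinearMap.mem_ker, map_smul] at hy hz
  obtain ⟨α, β, rfl⟩ := Ideal.mem_span_pair.mp hc
  apply hX
  change (α * a + β * b) • f w = (α * a + β * b) • 0
  rw [add_smul, mul_smul, mul_smul, hy, hz]
  simp

open RingTheory.Sequence in
theorem seqDepth_quotient_succ_le [IsNoetherianRing R] [IsLocalRing R] {x : R}
    (hx : x ∈ maximalIdeal R) (hxreg : IsSMulRegular R x) [IsLocalRing (R ⧸ Ideal.span {x})] :
    seqDepth (R ⧸ Ideal.span {x}) (R ⧸ Ideal.span {x}) (maximalIdeal (R ⧸ Ideal.span {x})) + 1 ≤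
      seqDepth R R (maximalIdeal R) := by
  have hmk : Function.Surjective (algebraMap R (R ⧸ Ideal.span {x})) :=
    Ideal.Quotient.mk_surjective
  rw [seqDepth, ENat.sSup_add]
  swap
  · exact ⟨0, [], by simp, by simp, .nil _ _⟩
  refine iSup₂_le ?_
  rintro _ ⟨rs, rfl, hrs, hreg⟩
  obtain ⟨rs, rfl⟩ := List.map_surjective_iff.mpr hmk rs
  have hmem : ∀ r ∈ x :: rs, r ∈ maximalIdeal R := by
    intro r hr
    rcases List.mem_cons.mp hr with rfl | hr
    · exact hx
    · have := hrs _ (List.mem_map_of_mem hr)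
      rw [mem_maximalIdeal, mem_nonunits_iff] at this ⊢
      exact fun h ↦ this (h.map _)
  have hweak : IsWeaklyRegular R (x :: rs) := by
    rw [isWeaklyRegular_cons_iff]
    refine ⟨hxreg, ?_⟩
    have h1 := (isWeaklyRegular_map_algebraMap_iff _ _ _).mp hreg.toIsWeaklyRegular
    refine (LinearEquiv.isWeaklyRegular_congr (Submodule.quotEquivOfEq _ _ ?_) _).mp h1
    rw [← Submodule.ideal_span_singleton_smul, smul_eq_mul, Ideal.mul_top]
  refine le_sSup ⟨x :: rs, by simp, hmem, ?_⟩
  exact IsRegular.of_isWeaklyRegular_of_mem_maximalIdeal _ hmem hweak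

theorem exists_isSMulRegular_quotient_of_isRegularModulo [IsNoetherianRing R] [IsLocalRing R]
    {x p q : R} (hxreg : IsSMulRegular R x) (hp : p ∈ maximalIdeal R)
    (hq : q ∈ maximalIdeal R) (hreg : IsSMulRegular R p)
    (hpq : IsRegularModulo (⊤ : Ideal R) p q) :
    ∃ r ∈ maximalIdeal R, IsSMulRegular (R ⧸ Ideal.span {x}) r := by
  by_contra! hcon
  have hsub : (maximalIdeal R : Set R) ⊆
      ⋃ P ∈ associatedPrimes R (R ⧸ Ideal.span {x}), (P : Set R) := by
    rw [biUnion_associatedPrimes_eq_zero_divisors]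
    intro r hr
    have := hcon r hr
    rw [isSMulRegular_iff_right_eq_zero_of_smul] at this
    push Not at this
    obtain ⟨z, hz, hz0⟩ := this
    exact ⟨z, hz0, hz⟩
  obtain ⟨P, hP, hle⟩ := (Ideal.subset_union_prime_finite
    (associatedPrimes.finite R (R ⧸ Ideal.span {x})) (f := id) 0 0
    fun _ h _ _ ↦ h.isPrime).mp hsub
  obtain ⟨hprime, s, hs⟩ := (Submodule.isAssociatedPrime_iff (N := ⊥)).mp hP
  obtain ⟨s, rfl⟩ := Ideal.Quotient.mk_surjective s
  have hkill (r : R) (hr : r ∈ maximalIdeal R) : ∃ u, r * s = x * u := by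
    have := hle hr
    simp only [id] at this
    rw [hs, Submodule.mem_colon_singleton, Submodule.mem_bot] at this
    exact Ideal.mem_span_singleton.mp (Ideal.Quotient.eq_zero_iff_mem.mp this)
  obtain ⟨u, hu⟩ := hkill p hp
  obtain ⟨v, hv⟩ := hkill q hq
  obtain ⟨w, -, rfl⟩ := hpq u trivial v trivial <| by
    apply hxreg
    simp only [smul_eq_mul]
    linear_combination p * hv - q * hu
  have hsw : s = x * w := by
    apply hreg
    simp only [smul_eq_mul] at hu ⊢
    linear_combination hu
  apply hprime.ne_top
  rw [hs, (Ideal.Quotient.eq_zero_iff_mem.mpr (Ideal.mem_span_singleton.mpr ⟨w, hsw⟩) :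
    Ideal.Quotient.mk (Ideal.span {x}) s = 0)]
  simp

end Depth

/-- Let `(B,𝔫)` be a two-dimensional Cohen–Macaulay Noetherian local ring with minimal
multiplicity and let `x ∈ 𝔫` be a `B`-regular element.  Then `A = B/(x)` is a
one-dimensional Cohen–Macaulay local ring and the Hilbert function of every maximal
Cohen–Macaulay `A`-module is non-decreasing. -/
theorem hilbert_monotone_of_hypersurface_section_of_minimal_multiplicity.{u}
    (B : Type u) [CommRing B] [IsNoetherianRing B] [IsLocalRing B]
    (hdimB : ringKrullDim B = 2)
    (hdepthB : seqDepth B B (maximalIdeal B) = 2)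
    (hminmult : HasMinimalMultiplicity B 2)
    (x : B) (hx : x ∈ maximalIdeal B) (hxreg : x ∈ nonZeroDivisors B) :
    ∃ _ : IsLocalRing (B ⧸ Ideal.span {x}),
      ringKrullDim (B ⧸ Ideal.span {x}) = 1 ∧
      seqDepth (B ⧸ Ideal.span {x}) (B ⧸ Ideal.span {x})
        (maximalIdeal (B ⧸ Ideal.span {x})) = 1 ∧
      ∀ (M : Type u) [AddCommGroup M] [Module (B ⧸ Ideal.span {x}) M]
        [Module.Finite (B ⧸ Ideal.span {x}) M], Nontrivial M →
        seqDepth (B ⧸ Ideal.span {x}) M (maximalIdeal (B ⧸ Ideal.span {x})) = 1 →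
        ∀ n : ℕ, hilbertFn (B ⧸ Ideal.span {x}) M (maximalIdeal (B ⧸ Ideal.span {x})) n ≤
          hilbertFn (B ⧸ Ideal.span {x}) M (maximalIdeal (B ⧸ Ideal.span {x})) (n + 1) := by
  have hxB : IsSMulRegular B x := by
    rw [isSMulRegular_iff_right_eq_zero_of_smul]
    intro z hz
    exact (mem_nonZeroDivisors_iff.mp hxreg).1 z hz
  have hmk : Function.Surjective (algebraMap B (B ⧸ Ideal.span {x})) :=
    Ideal.Quotient.mk_surjective
  have : Nontrivial (B ⧸ Ideal.span {x}) :=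
    Ideal.Quotient.nontrivial_iff.mpr fun h ↦
      (Ideal.ne_top_iff_one _).mp (maximalIdeal.isMaximal B).ne_top
        ((Ideal.span_singleton_le_iff_mem _).mpr hx (h ▸ trivial))
  have hloc : IsLocalRing (B ⧸ Ideal.span {x}) := .of_surjective' (Ideal.Quotient.mk _) hmk
  obtain ⟨p, hp, q, hq, hreg, hpq⟩ := exists_isRegularModulo_of_one_lt_seqDepth
    (I := maximalIdeal B) (by rw [hdepthB]; exact Nat.one_lt_ofNat)
  refine ⟨hloc, ?_, le_antisymm ?_ ?_, ?_⟩
  · have := ringKrullDim_quotient_span_singleton_succ_eq_ringKrullDim_of_mem_nonZeroDivisors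
      hxreg hx
    rw [hdimB] at this
    generalize ringKrullDim (B ⧸ Ideal.span {x}) = d at this
    induction d with
    | bot => simp at this
    | coe d =>
      have h2 : d + 1 = 1 + 1 := WithBot.coe_injective (this.trans one_add_one_eq_two.symm)
      rw [(ENat.add_left_injective_of_ne_top ENat.one_ne_top) h2]
      rfl
  · have := seqDepth_quotient_succ_le hx hxB
    rw [hdepthB, ← one_add_one_eq_two] at this
    exact (ENat.add_le_add_iff_right ENat.one_ne_top).mp this
  · obtain ⟨r, hr, hrreg⟩ :=
      exists_isSMulRegular_quotient_of_isRegularModulo hxB hp hq hreg hpq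
    have hr' : algebraMap B (B ⧸ Ideal.span {x}) r ∈ maximalIdeal (B ⧸ Ideal.span {x}) := by
      rw [← map_maximalIdeal_of_surjective _ hmk]
      exact Ideal.mem_map_of_mem _ hr
    refine le_sSup ⟨[algebraMap B (B ⧸ Ideal.span {x}) r], by simp, by simpa using hr', ?_⟩
    refine RingTheory.Sequence.IsRegular.of_isWeaklyRegular_of_mem_maximalIdeal _
      (by simpa using hr') ?_
    rw [RingTheory.Sequence.isWeaklyRegular_singleton_iff]
    exact (isSMulRegular_algebraMap_iff _).mpr hrreg
  · intro M _ _ _ _ hdepth n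
    obtain ⟨y, hy, hsq⟩ := hminmult
    have hrange : Set.range y = {y 0, y 1} := by
      ext; simp [eq_comm]
    rw [hrange] at hsq
    have hsqle : ∀ r ∈ maximalIdeal B, r ^ 2 ∈ Ideal.span {y 0, y 1} := by
      intro r hr
      have := Ideal.pow_mem_pow hr 2
      rw [hsq] at this
      exact Ideal.mul_le_left this
    have hK := fun u v : B ↦ exists_koszul_boundary (u := u) (v := v) (hsqle p hp) (hsqle q hq)
      (hreg.pow 2) (isRegularModulo_pow_pow hreg hpq 2 2)
    have hyreg : IsSMulRegular B (y 0) := isSMulRegular_of_koszul (hy 1) hK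
    let : Module B M := Module.compHom M (algebraMap B (B ⧸ Ideal.span {x}))
    have : IsScalarTower B (B ⧸ Ideal.span {x}) M := .of_algebraMap_smul fun _ _ ↦ rfl
    have : Module.Finite B M := .trans (B ⧸ Ideal.span {x}) M
    obtain ⟨k, f, hf⟩ := Module.Finite.exists_fin' B M
    obtain ⟨c, hc, hcM⟩ := exists_isSMulRegular_of_zero_lt_seqDepth
      (I := maximalIdeal (B ⧸ Ideal.span {x})) (M := M) (by rw [hdepth]; exact one_pos)
    obtain ⟨c, rfl⟩ := hmk c
    have hcB : c ∈ maximalIdeal B := by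
      rw [mem_maximalIdeal, mem_nonunits_iff] at hc ⊢
      exact fun h ↦ hc (h.map _)
    have hN := isRegularModulo_ker_of_koszul hK (hsqle c hcB)
      (((isSMulRegular_algebraMap_iff _).mp hcM).pow 2) f
    have htop : IsRegularModulo (⊤ : Submodule B (Fin k → B)) (y 0) (y 1) := by
      rw [← LinearMap.ker_zero (R := B) (R₂ := B) (τ₁₂ := .id B) (M := Fin k → B)
        (M₂ := PUnit)]
      exact isRegularModulo_ker_of_koszul hK (zero_mem _) (fun _ _ _ ↦ rfl) 0
    have hyk : IsSMulRegular (Fin k → B) (y 0) := .pi fun _ ↦ hyreg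
    rw [← map_maximalIdeal_of_surjective _ hmk, hilbertFn_map_eq_intervalLength hmk f hf,
      hilbertFn_map_eq_intervalLength hmk f hf, WithBot.coe_le_coe]
    exact intervalLength_pow_smul_sup_le (hy 0) (hy 1) hsq hyk hN htop n
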